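/- arXiv:2404.19344 — 2 statements merged into one kernel-verified Lean document; each statement's English description precedes it below -/
import Mathlib

section
/- Let T ≥ 2 be an integer, let 1 ≤ s < r < e ≤ T be integers, let f ∈ ℝ^T be continuous piecewise-linear on [s,e] with exactly one change-point (kink) at r, with kink magnitude Δ, let X ∈ ℝ^T and set ε = X − f. Let C₃ = 63^{1/3}·(2√2 + 4)^{2/3}. Assume: (i) |⟨ε, ϕ^b_{s,e}⟩| ≤ √(8·log T) for every integer b with s < b < e; (ii) |⟨ϕ^b_{s,e}·⟨f,ϕ^b_{s,e}⟩ − ϕ^r_{s,e}·⟨f,ϕ^r_{s,e}⟩, ε⟩| ≤ √(8·log T)·‖ϕ^b_{s,e}·⟨f,ϕ^b_{s,e}⟩ − ϕ^r_{s,e}·⟨f,ϕ^r_{s,e}⟩‖₂ for every integer b with s < b < e; and (iii) min{r − s, e − r}·Δ^{2/3} > C₃·(log T)^{1/3}. Then every integer b* with s < b* < e and |b* − r|·Δ^{2/3} > C₃·(log T)^{1/3} satisfies C^r_{s,e}(X)² > C^{b*}_{s,e}(X)²; consequently, every integer b̂ with s < b̂ < e that maximizes C^b_{s,e}(X) over b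 ∈ {s+1,…,e−1} satisfies |b̂ − r|·Δ^{2/3} ≤ C₃·(log T)^{1/3}. -/
open Real Finset

/-- Normalizing constant `α^b_{s,e}` of the linear contrast vector. -/
noncomputable def alphaC (s b e : ℕ) : ℝ :=
  Real.sqrt (6 / (((e : ℝ) - s + 1) * (((e : ℝ) - s + 1) ^ 2 - 1) *
    (1 + ((e : ℝ) - b + 1) * ((b : ℝ) - s + 1) + ((e : ℝ) - b) * ((b : ℝ) - s))))

/-- Normalizing constant `β^b_{s,e}` of the linear contrast vector. -/
noncomputable def betaC (s b e : ℕ) : ℝ :=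
  Real.sqrt ((((e : ℝ) - b + 1) * ((e : ℝ) - b)) / (((b : ℝ) - s + 1) * ((b : ℝ) - s)))

/-- The linear contrast vector `ϕ^b_{s,e}`, given coordinatewise as a function of `t`. -/
noncomputable def phiC (s b e t : ℕ) : ℝ :=
  if s ≤ t ∧ t ≤ b then
    alphaC s b e * betaC s b e *
      (((e : ℝ) + 2 * b - 3 * s + 2) * t - ((b : ℝ) * e + (b : ℝ) * s - 2 * (s : ℝ) ^ 2 + 2 * s))
  else if b + 1 ≤ t ∧ t ≤ e then
    -(alphaC s b e / betaC s b e) *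
      ((3 * (e : ℝ) - 2 * b - s + 2) * t - (2 * (e : ℝ) ^ 2 + 2 * e - (b : ℝ) * e - (b : ℝ) * s))
  else 0

/-- Euclidean inner product on `ℝ^T`, with coordinates indexed by `1, …, T`. -/
noncomputable def innerT (T : ℕ) (x y : ℕ → ℝ) : ℝ := ∑ t ∈ Finset.Icc 1 T, x t * y t

/-- The contrast value `C^b_{s,e}(x) = |⟨x, ϕ^b_{s,e}⟩|`. -/
noncomputable def contrastC (T s b e : ℕ) (x : ℕ → ℝ) : ℝ := |innerT T x (phiC s b e)|

/-- Euclidean norm on `ℝ^T`, with coordinates indexed by `1, …, T`. -/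
noncomputable def normT (T : ℕ) (x : ℕ → ℝ) : ℝ :=
  Real.sqrt (∑ t ∈ Finset.Icc 1 T, (x t) ^ 2)

lemma sum_split (s m n : ℕ) (g : ℕ → ℝ) :
    ∑ t ∈ Finset.Icc s (s + m + n), g t =
      ∑ i ∈ Finset.range (m + 1), g (s + i) + ∑ i ∈ Finset.range n, g (s + m + 1 + i) := by
  have h : Finset.Icc s (s + m + n) = Finset.Ico s (s + m + n + 1) := by
    ext x; simp only [Finset.mem_Icc, Finset.mem_Ico]; omega
  rw [h, ← Finset.sum_Ico_consecutive g (show s ≤ s + m + 1 by omega)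
    (show s + m + 1 ≤ s + m + n + 1 by omega), Finset.sum_Ico_eq_sum_range,
    Finset.sum_Ico_eq_sum_range]
  have e1 : s + m + 1 - s = m + 1 := by omega
  have e2 : s + m + n + 1 - (s + m + 1) = n := by omega
  rw [e1, e2]

lemma sum_aff (p q : ℝ) (k : ℕ) :
    ∑ i ∈ Finset.range k, (p * i + q) = p * (k * (k - 1) / 2) + q * k := by
  induction k with
  | zero => simp
  | succ k ih => rw [Finset.sum_range_succ, ih]; push_cast; ring

lemma sum_aff2 (p q a b : ℝ) (k : ℕ) :
    ∑ i ∈ Finset.range k, (a * i + b) * (p * i + q) =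
      p * a * (k * (k - 1) * (2 * k - 1) / 6) + (a * q + b * p) * (k * (k - 1) / 2) + b * q * k := by
  induction k with
  | zero => simp
  | succ k ih => rw [Finset.sum_range_succ, ih]; push_cast; ring

lemma phi_left (s m n i : ℕ) (hi : i ≤ m) :
    phiC s (s + m) (s + m + n) (s + i) =
      alphaC s (s + m) (s + m + n) * betaC s (s + m) (s + m + n) *
        ((3 * m + n + 2) * i + (-(m * (m + n)))) := by
  unfold phiC
  rw [if_pos (by omega)]
  push_cast
  ring

lemma phi_right (s m n i : ℕ) (hi : i < n) :
    phiC s (s + m) (s + m + n) (s + m + 1 + i) =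
      alphaC s (s + m) (s + m + n) / betaC s (s + m) (s + m + n) *
        (-(3 * n + m + 2) * i + ((3 * n + m + 2) * (n - 1) - n * (m + n))) := by
  unfold phiC
  rw [if_neg (by omega), if_pos (by omega)]
  push_cast
  ring

lemma phi_prop (s b e : ℕ) (hsb : s < b) (hbe : b < e) :
    (∃ u v c : ℝ, c ≠ 0 ∧ ∀ t : ℕ, s ≤ t → t ≤ e →
      phiC s b e t = u + v * t + c * max ((t : ℝ) - b) 0) ∧
    ∑ t ∈ Finset.Icc s e, phiC s b e t = 0 ∧
    ∑ t ∈ Finset.Icc s e, (t : ℝ) * phiC s b e t = 0 ∧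
    ∑ t ∈ Finset.Icc s e, phiC s b e t * phiC s b e t = 1 := by
  obtain ⟨m, rfl⟩ : ∃ m, b = s + m := ⟨b - s, by omega⟩
  obtain ⟨n, rfl⟩ : ∃ n, e = s + m + n := ⟨e - (s + m), by omega⟩
  have hm : (0 : ℝ) < m := by exact_mod_cast (show 0 < m by omega)
  have hn : (0 : ℝ) < n := by exact_mod_cast (show 0 < n by omega)
  have L := phi_left s m n
  have R := phi_right s m n
  have hα2 : alphaC s (s + m) (s + m + n) ^ 2 =
      6 / ((m + n + 1) * ((m + n + 1) ^ 2 - 1) * (1 + (n + 1) * (m + 1) + n * m)) := by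
    unfold alphaC
    have e1 : ((s + m + n : ℕ) : ℝ) - s = m + n := by push_cast; ring
    have e2 : ((s + m + n : ℕ) : ℝ) - (s + m : ℕ) = n := by push_cast; ring
    have e3 : ((s + m : ℕ) : ℝ) - s = m := by push_cast; ring
    rw [e1, e2, e3, Real.sq_sqrt]
    have : (0 : ℝ) < ((m : ℝ) + n + 1) ^ 2 - 1 := by nlinarith
    positivity
  have hβ2 : betaC s (s + m) (s + m + n) ^ 2 = ((n + 1) * n) / ((m + 1) * m) := by
    unfold betaC
    have e2 : ((s + m + n : ℕ) : ℝ) - (s + m : ℕ) = n := by push_cast; ring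
    have e3 : ((s + m : ℕ) : ℝ) - s = m := by push_cast; ring
    rw [e2, e3, Real.sq_sqrt]
    positivity
  have hα0 : 0 ≤ alphaC s (s + m) (s + m + n) := Real.sqrt_nonneg _
  have hβ0 : 0 ≤ betaC s (s + m) (s + m + n) := Real.sqrt_nonneg _
  generalize alphaC s (s + m) (s + m + n) = α at *
  generalize betaC s (s + m) (s + m + n) = β at *
  have hq : (0 : ℝ) < ((m : ℝ) + n + 1) ^ 2 - 1 := by nlinarith
  have hα : 0 < α := by
    have : 0 < α ^ 2 := by rw [hα2]; positivity
    exact lt_of_le_of_ne hα0 (by rintro rfl; simp at this)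
  have hβ : 0 < β := by
    have : 0 < β ^ 2 := by rw [hβ2]; positivity
    exact lt_of_le_of_ne hβ0 (by rintro rfl; simp at this)
  have hb : β ^ 2 * ((m + 1) * m) = (n + 1) * n := by
    rw [hβ2]; field_simp
  have hd : α * β = α / β * β ^ 2 := by field_simp
  refine ⟨⟨-(α * β * (m * (m + n))) - α * β * (3 * m + n + 2) * s, α * β * (3 * m + n + 2),
    -(α / β * (3 * n + m + 2)) - α * β * (3 * m + n + 2), ?_, ?_⟩, ?_, ?_, ?_⟩
  · have h1 : 0 < α / β * (3 * n + m + 2) := by positivity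
    have h2 : 0 < α * β * (3 * m + n + 2) := by positivity
    linarith
  · intro t h1 h2
    by_cases h : t ≤ s + m
    · obtain ⟨i, rfl⟩ : ∃ i, t = s + i := ⟨t - s, by omega⟩
      rw [L i (by omega), max_eq_right]
      · push_cast; ring
      · rw [sub_nonpos]; exact_mod_cast h
    · obtain ⟨i, rfl⟩ : ∃ i, t = s + m + 1 + i := ⟨t - (s + m + 1), by omega⟩
      rw [R i (by omega), max_eq_left]
      · rw [hd]; push_cast; linear_combination (-2 * (α / β)) * hb
      · rw [sub_nonneg]; exact_mod_cast (by omega)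
  · rw [sum_split, Finset.sum_congr rfl (fun i hi => L i (by simp at hi; omega)),
      Finset.sum_congr rfl (fun i hi => R i (by simpa using hi)), ← Finset.mul_sum,
      ← Finset.mul_sum, sum_aff, sum_aff, hd]
    push_cast
    linear_combination (α / β * (m - n + 2) / 2) * hb
  · have L' : ∀ i ∈ Finset.range (m + 1), ((s + i : ℕ) : ℝ) * phiC s (s + m) (s + m + n) (s + i) =
        α * β * ((1 * i + s) * ((3 * m + n + 2) * i + (-(m * (m + n))))) := by
      intro i hi
      rw [L i (by simp at hi; omega)]; push_cast; ring
    have R' : ∀ i ∈ Finset.range n,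
        ((s + m + 1 + i : ℕ) : ℝ) * phiC s (s + m) (s + m + n) (s + m + 1 + i) =
        α / β * ((1 * i + (s + m + 1)) *
          (-(3 * n + m + 2) * i + ((3 * n + m + 2) * (n - 1) - n * (m + n)))) := by
      intro i hi
      rw [R i (by simpa using hi)]; push_cast; ring
    rw [sum_split, Finset.sum_congr rfl L', Finset.sum_congr rfl R', ← Finset.mul_sum,
      ← Finset.mul_sum, sum_aff2, sum_aff2, hd, hβ2]
    push_cast
    field_simp
    ring
  · have L' : ∀ i ∈ Finset.range (m + 1),
        phiC s (s + m) (s + m + n) (s + i) * phiC s (s + m) (s + m + n) (s + i) =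
        α ^ 2 * β ^ 2 * (((3 * m + n + 2) * i + (-(m * (m + n)))) *
          ((3 * m + n + 2) * i + (-(m * (m + n))))) := by
      intro i hi
      rw [L i (by simp at hi; omega)]; ring
    have R' : ∀ i ∈ Finset.range n,
        phiC s (s + m) (s + m + n) (s + m + 1 + i) * phiC s (s + m) (s + m + n) (s + m + 1 + i) =
        α ^ 2 / β ^ 2 * ((-(3 * n + m + 2) * i + ((3 * n + m + 2) * (n - 1) - n * (m + n))) *
          (-(3 * n + m + 2) * i + ((3 * n + m + 2) * (n - 1) - n * (m + n)))) := by
      intro i hi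
      rw [R i (by simpa using hi)]; ring
    rw [sum_split, Finset.sum_congr rfl L', Finset.sum_congr rfl R', ← Finset.mul_sum,
      ← Finset.mul_sum, sum_aff2, sum_aff2, hα2, hβ2]
    have hq' : ((m : ℝ) + n + 1) ^ 2 - 1 = (m + n) * (m + n + 2) := by ring
    rw [hq']
    push_cast
    field_simp
    ring

lemma sym_lower (h : ℕ → ℝ) (r k : ℕ) (hk : k ≤ r) :
    h r ^ 2 + ∑ j ∈ Finset.range k, (h (r + (j + 1)) + h (r - (j + 1))) ^ 2 / 2 ≤
      ∑ t ∈ Finset.Icc (r - k) (r + k), h t ^ 2 := by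
  induction k with
  | zero => simp
  | succ k ih =>
    have e1 : Finset.Icc (r - (k + 1)) (r + (k + 1)) =
        insert (r - (k + 1)) (insert (r + (k + 1)) (Finset.Icc (r - k) (r + k))) := by
      ext x; simp only [Finset.mem_Icc, Finset.mem_insert]; omega
    rw [e1, Finset.sum_insert (by simp; omega), Finset.sum_insert (by simp),
      Finset.sum_range_succ]
    have := ih (by omega)
    nlinarith [sq_nonneg (h (r + (k + 1)) - h (r - (k + 1)))]

lemma window_lower (h : ℕ → ℝ) (r k : ℕ) (hk : k ≤ r) (u v κ : ℝ)
    (hh : ∀ t, r - k ≤ t → t ≤ r + k → h t = u + v * ((t : ℝ) - r) + κ * max ((t : ℝ) - r) 0) :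
    κ ^ 2 * (k : ℝ) ^ 3 / 63 ≤ ∑ t ∈ Finset.Icc (r - k) (r + k), h t ^ 2 := by
  refine le_trans ?_ (sym_lower h r k hk)
  have h0 : h r = u := by rw [hh r (by omega) (by omega)]; simp
  have h1 : ∀ j ∈ Finset.range k, (h (r + (j + 1)) + h (r - (j + 1))) ^ 2 / 2 =
      (κ / 2 * j + (κ + 2 * u) / 2) * (κ * j + (κ + 2 * u)) := by
    intro j hj
    have hj' : j < k := by simpa using hj
    rw [hh _ (by omega) (by omega), hh (r - (j + 1)) (by omega) (by omega),
      Nat.cast_sub (by omega), max_eq_left (by push_cast; linarith [Nat.cast_nonneg (α := ℝ) j]),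
      max_eq_right (by push_cast; linarith [Nat.cast_nonneg (α := ℝ) j])]
    push_cast; ring
  rw [Finset.sum_congr rfl h1, sum_aff2, h0]
  have hk0 : (0 : ℝ) ≤ k := Nat.cast_nonneg k
  generalize (k : ℝ) = x at *
  have key : 0 ≤ (2 * x + 1) * (u ^ 2 + (κ * (κ / 2) * (x * (x - 1) * (2 * x - 1) / 6) +
      (κ / 2 * (κ + 2 * u) + (κ + 2 * u) / 2 * κ) * (x * (x - 1) / 2) +
      (κ + 2 * u) / 2 * (κ + 2 * u) * x) - κ ^ 2 * x ^ 3 / 63) := by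
    have : (2 * x + 1) * (u ^ 2 + (κ * (κ / 2) * (x * (x - 1) * (2 * x - 1) / 6) +
      (κ / 2 * (κ + 2 * u) + (κ + 2 * u) / 2 * κ) * (x * (x - 1) / 2) +
      (κ + 2 * u) / 2 * (κ + 2 * u) * x) - κ ^ 2 * x ^ 3 / 63) =
      ((2 * x + 1) * u + κ * x * (x + 1) / 2) ^ 2 +
      κ ^ 2 * (x * (x + 1) * (x ^ 2 + x + 1) / 12 - (2 * x + 1) * x ^ 3 / 63) := by ring
    rw [this]
    have h3 : 0 ≤ x * (x + 1) * (x ^ 2 + x + 1) / 12 - (2 * x + 1) * x ^ 3 / 63 := by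
      have : x * (x + 1) * (x ^ 2 + x + 1) / 12 - (2 * x + 1) * x ^ 3 / 63 =
        (13 * x ^ 4 + 38 * x ^ 3 + 42 * x ^ 2 + 21 * x) / 252 := by ring
      rw [this]; positivity
    positivity
  have := nonneg_of_mul_nonneg_right key (by positivity)
  linarith

lemma inner_phi (T s b e : ℕ) (hs : 1 ≤ s) (hsb : s < b) (hbe : b < e) (heT : e ≤ T) (x : ℕ → ℝ) :
    innerT T x (phiC s b e) = ∑ t ∈ Finset.Icc s e, x t * phiC s b e t := by
  unfold innerT
  symm
  apply Finset.sum_subset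
  · intro t ht; simp at *; omega
  · intro t _ ht
    have : phiC s b e t = 0 := by
      unfold phiC
      simp at ht
      rw [if_neg (by omega), if_neg (by omega)]
    rw [this, mul_zero]

/-- The deterministic heart: identity for the squared norm and lower bound. -/
lemma heart (T s r e : ℕ) (hs : 1 ≤ s) (hsr : s < r) (hre : r < e)
    (heT : e ≤ T) (f : ℕ → ℝ) (a₁ b₁ a₂ b₂ : ℝ)
    (hcont : a₁ + b₁ * r = a₂ + b₂ * r)
    (hf₁ : ∀ t, s ≤ t → t ≤ r → f t = a₁ + b₁ * t)
    (hf₂ : ∀ t, r ≤ t → t ≤ e → f t = a₂ + b₂ * t)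
    (b : ℕ) (hsb : s < b) (hbe : b < e) (k : ℕ) (hk1 : k ≤ r - s) (hk2 : k ≤ e - r)
    (hk3 : b + k ≤ r ∨ r + k ≤ b) :
    normT T (fun t =>
      phiC s b e t * innerT T f (phiC s b e) - phiC s r e t * innerT T f (phiC s r e)) ^ 2 =
      innerT T f (phiC s r e) ^ 2 - innerT T f (phiC s b e) ^ 2 ∧
    (b₁ - b₂) ^ 2 * (k : ℝ) ^ 3 / 63 ≤
      innerT T f (phiC s r e) ^ 2 - innerT T f (phiC s b e) ^ 2 := by
  obtain ⟨⟨ur, vr, cr, hcr, hφr⟩, hr0, hr1, hr2⟩ := phi_prop s r e hsr hre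
  obtain ⟨⟨ub, vb, cb, hcb, hφb⟩, hb0, hb1, hb2⟩ := phi_prop s b e hsb hbe
  have hf : ∀ t, s ≤ t → t ≤ e → f t = a₁ + b₁ * t + (b₂ - b₁) * max ((t : ℝ) - r) 0 := by
    intro t h1 h2
    rcases le_total t r with h | h
    · have : (t : ℝ) ≤ r := by exact_mod_cast h
      rw [hf₁ t h1 h, max_eq_right (by linarith)]; ring
    · have : (r : ℝ) ≤ t := by exact_mod_cast h
      rw [hf₂ t h h2, max_eq_left (by linarith)]; linear_combination -hcont
  set A := (b₂ - b₁) / cr with hA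
  have hAc : A * cr = b₂ - b₁ := by rw [hA]; field_simp
  set p := a₁ - A * ur with hp
  set q := b₁ - A * vr with hq
  have hf' : ∀ t, s ≤ t → t ≤ e → f t = p + q * t + A * phiC s r e t := by
    intro t h1 h2
    rw [hf t h1 h2, hφr t h1 h2, hp, hq, ← hAc]; ring
  have hinner : ∀ c, s < c → c < e → innerT T f (phiC s c e) =
      A * ∑ t ∈ Finset.Icc s e, phiC s r e t * phiC s c e t := by
    intro c h1 h2
    obtain ⟨-, hc0, hc1, -⟩ := phi_prop s c e h1 h2
    rw [inner_phi T s c e hs h1 h2 heT]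
    have : ∀ t ∈ Finset.Icc s e, f t * phiC s c e t =
        p * phiC s c e t + q * (t * phiC s c e t) + A * (phiC s r e t * phiC s c e t) := by
      intro t ht
      simp at ht
      rw [hf' t ht.1 ht.2]; ring
    rw [Finset.sum_congr rfl this, Finset.sum_add_distrib, Finset.sum_add_distrib,
      ← Finset.mul_sum, ← Finset.mul_sum, ← Finset.mul_sum, hc0, hc1]
    ring
  have hAr := hinner r hsr hre
  rw [hr2, mul_one] at hAr
  have hAb := hinner b hsb hbe
  set B := innerT T f (phiC s b e) with hB
  rw [hAr]
  have hnorm : ∑ t ∈ Finset.Icc s e, (phiC s b e t * B - phiC s r e t * A) ^ 2 = A ^ 2 - B ^ 2 := by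
    have : ∀ t ∈ Finset.Icc s e, (phiC s b e t * B - phiC s r e t * A) ^ 2 =
        B ^ 2 * (phiC s b e t * phiC s b e t) - 2 * A * B * (phiC s r e t * phiC s b e t) +
        A ^ 2 * (phiC s r e t * phiC s r e t) := by intro t _; ring
    rw [Finset.sum_congr rfl this, Finset.sum_add_distrib, Finset.sum_sub_distrib,
      ← Finset.mul_sum, ← Finset.mul_sum, ← Finset.mul_sum, hb2, hr2]
    linear_combination 2 * B * hAb
  constructor
  · unfold normT
    rw [Real.sq_sqrt (Finset.sum_nonneg fun _ _ => sq_nonneg _), ← hnorm]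
    symm
    apply Finset.sum_subset
    · intro t ht; simp at *; omega
    · intro t _ ht
      have h0 : ∀ c, s < c → c < e → phiC s c e t = 0 := by
        intro c h1 h2
        unfold phiC
        simp at ht
        rw [if_neg (by omega), if_neg (by omega)]
      rw [h0 b hsb hbe, h0 r hsr hre]; ring
  · rw [← hnorm]
    have hsub : Finset.Icc (r - k) (r + k) ⊆ Finset.Icc s e := by
      intro t ht; simp at *; omega
    refine le_trans ?_ (Finset.sum_le_sum_of_subset_of_nonneg hsub fun _ _ _ => sq_nonneg _)
    rcases hk3 with h | h
    · refine window_lower (fun t => phiC s b e t * B - phiC s r e t * A) r k (by omega)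
        (B * (ub + vb * r + cb * (r - b)) - A * (ur + vr * r)) (B * (vb + cb) - A * vr)
        (b₁ - b₂) ?_
      intro t h1 h2
      have hbt : (b : ℝ) ≤ t := by exact_mod_cast (by omega : b ≤ t)
      rw [hφb t (by omega) (by omega), hφr t (by omega) (by omega),
        max_eq_left (show (0 : ℝ) ≤ t - b by linarith)]
      linear_combination (-max ((t : ℝ) - r) 0) * hAc
    · refine window_lower (fun t => phiC s b e t * B - phiC s r e t * A) r k (by omega)
        (B * (ub + vb * r) - A * (ur + vr * r)) (B * vb - A * vr)
        (b₁ - b₂) ?_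
      intro t h1 h2
      have hbt : (t : ℝ) ≤ b := by exact_mod_cast (by omega : t ≤ b)
      rw [hφb t (by omega) (by omega), hφr t (by omega) (by omega),
        max_eq_right (show (t : ℝ) - b ≤ 0 by linarith)]
      linear_combination (-max ((t : ℝ) - r) 0) * hAc

/-- localization of the contrast maximizer near the true kink location, with
`C₃ = 63^{1/3}·(2√2 + 4)^{2/3}`. -/
theorem statement14 (T s r e : ℕ) (hT : 2 ≤ T) (hs : 1 ≤ s) (hsr : s < r) (hre : r < e)
    (heT : e ≤ T) (f X : ℕ → ℝ) (a₁ b₁ a₂ b₂ Δ : ℝ) (hslope : b₁ ≠ b₂)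
    (hcont : a₁ + b₁ * r = a₂ + b₂ * r)
    (hf₁ : ∀ t, s ≤ t → t ≤ r → f t = a₁ + b₁ * t)
    (hf₂ : ∀ t, r ≤ t → t ≤ e → f t = a₂ + b₂ * t)
    (hΔ : Δ = |b₁ - b₂|) (ε : ℕ → ℝ) (hε : ε = fun t => X t - f t)
    (C₃ : ℝ) (hC₃ : C₃ = (63 : ℝ) ^ ((1 : ℝ) / 3) * (2 * Real.sqrt 2 + 4) ^ ((2 : ℝ) / 3))
    (h1 : ∀ b, s < b → b < e → |innerT T ε (phiC s b e)| ≤ Real.sqrt (8 * Real.log T))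
    (h2 : ∀ b, s < b → b < e →
      |innerT T (fun t =>
          phiC s b e t * innerT T f (phiC s b e) - phiC s r e t * innerT T f (phiC s r e)) ε| ≤
        Real.sqrt (8 * Real.log T) *
          normT T (fun t =>
            phiC s b e t * innerT T f (phiC s b e) - phiC s r e t * innerT T f (phiC s r e)))
    (h3 : C₃ * (Real.log T) ^ ((1 : ℝ) / 3) <
      min ((r : ℝ) - s) ((e : ℝ) - r) * Δ ^ ((2 : ℝ) / 3)) :
    (∀ bstar, s < bstar → bstar < e →
        C₃ * (Real.log T) ^ ((1 : ℝ) / 3) < |(bstar : ℝ) - r| * Δ ^ ((2 : ℝ) / 3) →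
        (contrastC T s bstar e X) ^ 2 < (contrastC T s r e X) ^ 2) ∧
    (∀ bhat, s < bhat → bhat < e →
        (∀ b, s < b → b < e → contrastC T s b e X ≤ contrastC T s bhat e X) →
        |(bhat : ℝ) - r| * Δ ^ ((2 : ℝ) / 3) ≤ C₃ * (Real.log T) ^ ((1 : ℝ) / 3)) := by
  have hL : 0 < Real.log T := Real.log_pos (by exact_mod_cast (by omega : 1 < T))
  have hw : 0 < 2 * Real.sqrt 2 + 4 := by positivity
  have hΔ0 : 0 ≤ Δ := by rw [hΔ]; positivity
  have main : ∀ bstar, s < bstar → bstar < e →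
        C₃ * (Real.log T) ^ ((1 : ℝ) / 3) < |(bstar : ℝ) - r| * Δ ^ ((2 : ℝ) / 3) →
        (contrastC T s bstar e X) ^ 2 < (contrastC T s r e X) ^ 2 := by
    intro b hsb hbe hb
    obtain ⟨k, hk1, hk2, hk3, hk⟩ : ∃ k : ℕ, k ≤ r - s ∧ k ≤ e - r ∧ (b + k ≤ r ∨ r + k ≤ b) ∧
        C₃ * (Real.log T) ^ ((1 : ℝ) / 3) < k * Δ ^ ((2 : ℝ) / 3) := by
      have hD : 0 ≤ Δ ^ ((2 : ℝ) / 3) := by positivity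
      have g1 : C₃ * (Real.log T) ^ ((1 : ℝ) / 3) < ((r - s : ℕ) : ℝ) * Δ ^ ((2 : ℝ) / 3) := by
        rw [Nat.cast_sub hsr.le]
        exact h3.trans_le (mul_le_mul_of_nonneg_right (min_le_left _ _) hD)
      have g2 : C₃ * (Real.log T) ^ ((1 : ℝ) / 3) < ((e - r : ℕ) : ℝ) * Δ ^ ((2 : ℝ) / 3) := by
        rw [Nat.cast_sub hre.le]
        exact h3.trans_le (mul_le_mul_of_nonneg_right (min_le_right _ _) hD)
      obtain ⟨d, hd, hdd⟩ : ∃ d : ℕ, (d : ℝ) = |(b : ℝ) - r| ∧ (b + d = r ∨ r + d = b) := by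
        rcases le_total b r with h | h
        · have h' : (b : ℝ) ≤ r := by exact_mod_cast h
          exact ⟨r - b, by rw [Nat.cast_sub h, abs_of_nonpos (by linarith)]; ring, by omega⟩
        · have h' : (r : ℝ) ≤ b := by exact_mod_cast h
          exact ⟨b - r, by rw [Nat.cast_sub h, abs_of_nonneg (by linarith)], by omega⟩
      rw [← hd] at hb
      refine ⟨min d (min (r - s) (e - r)), by omega, by omega, by omega, ?_⟩
      rcases min_choice d (min (r - s) (e - r)) with h | h
      · rw [h]; exact hb
      · rw [h]
        rcases min_choice (r - s) (e - r) with h | h <;> rw [h] <;> assumption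
    obtain ⟨hn, hlow⟩ := heart T s r e hs hsr hre heT f a₁ b₁ a₂ b₂ hcont hf₁ hf₂ b hsb hbe k
      hk1 hk2 hk3
    have hcube : 63 * ((2 * Real.sqrt 2 + 4) ^ 2 * Real.log T) < (b₁ - b₂) ^ 2 * (k : ℝ) ^ 3 := by
      have h0 : 0 ≤ C₃ * (Real.log T) ^ ((1 : ℝ) / 3) := by rw [hC₃]; positivity
      have := pow_lt_pow_left₀ hk h0 (n := 3) (by norm_num)
      rw [hC₃, mul_pow, mul_pow, mul_pow] at this
      have c1 : ((63 : ℝ) ^ ((1 : ℝ) / 3)) ^ 3 = 63 := by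
        rw [← Real.rpow_natCast, ← Real.rpow_mul (by norm_num)]; norm_num
      have c2 : (Real.log T ^ ((1 : ℝ) / 3)) ^ 3 = Real.log T := by
        rw [← Real.rpow_natCast, ← Real.rpow_mul hL.le]; norm_num
      have c3 : ∀ x : ℝ, 0 ≤ x → (x ^ ((2 : ℝ) / 3)) ^ 3 = x ^ 2 := by
        intro x hx
        rw [← Real.rpow_natCast, ← Real.rpow_mul hx, ← Real.rpow_natCast]; norm_num
      rw [c1, c2, c3 _ hw.le, c3 _ hΔ0, hΔ, sq_abs] at this
      linarith
    have hsum : ∀ c, innerT T X (phiC s c e) =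
        innerT T f (phiC s c e) + innerT T ε (phiC s c e) := by
      intro c
      unfold innerT
      rw [← Finset.sum_add_distrib]
      refine Finset.sum_congr rfl fun t _ => ?_
      rw [hε]; ring
    have hcross : innerT T (fun t =>
          phiC s b e t * innerT T f (phiC s b e) - phiC s r e t * innerT T f (phiC s r e)) ε =
        innerT T f (phiC s b e) * innerT T ε (phiC s b e) -
          innerT T f (phiC s r e) * innerT T ε (phiC s r e) := by
      generalize innerT T f (phiC s b e) = B
      generalize innerT T f (phiC s r e) = A
      unfold innerT
      rw [Finset.mul_sum, Finset.mul_sum, ← Finset.sum_sub_distrib]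
      refine Finset.sum_congr rfl fun t _ => ?_
      ring
    have k1 := h1 b hsb hbe
    have k2 := h2 b hsb hbe
    rw [hcross] at k2
    unfold contrastC
    rw [sq_abs, sq_abs, hsum, hsum]
    have hN0 : 0 ≤ normT T (fun t =>
      phiC s b e t * innerT T f (phiC s b e) - phiC s r e t * innerT T f (phiC s r e)) :=
      Real.sqrt_nonneg _
    generalize normT T (fun t =>
      phiC s b e t * innerT T f (phiC s b e) - phiC s r e t * innerT T f (phiC s r e)) = N at *
    generalize innerT T f (phiC s b e) = B at *
    generalize innerT T f (phiC s r e) = A at *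
    generalize innerT T ε (phiC s b e) = x at *
    generalize innerT T ε (phiC s r e) = y at *
    have hS0 := Real.sqrt_nonneg (8 * Real.log T)
    have hS2 : Real.sqrt (8 * Real.log T) ^ 2 = 8 * Real.log T := Real.sq_sqrt (by positivity)
    set S := Real.sqrt (8 * Real.log T) with hS
    set w := Real.sqrt 2 with hwdef
    have hw2 : w ^ 2 = 2 := Real.sq_sqrt (by norm_num)
    have hw0 : 0 ≤ w := Real.sqrt_nonneg 2
    have hNS : ((1 + w) * S) ^ 2 < N ^ 2 := by
      rw [mul_pow, hS2, hn]
      have : (2 * w + 4) ^ 2 = 8 * (1 + w) ^ 2 := by linear_combination (-4) * hw2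
      rw [this] at hcube
      linarith
    have hNS' : (1 + w) * S < N := lt_of_pow_lt_pow_left₀ 2 hN0 hNS
    have hx2 : x ^ 2 ≤ S ^ 2 := by
      rw [← sq_abs x]; exact pow_le_pow_left₀ (abs_nonneg x) k1 2
    have hk2' := (abs_le.mp k2).2
    have hfin : 2 * S ^ 2 < (N - S) ^ 2 := by
      have h4 : w * S < N - S := by linarith
      have := pow_lt_pow_left₀ h4 (by positivity) (n := 2) (by norm_num)
      rw [mul_pow, hw2] at this
      exact this
    nlinarith [sq_nonneg y]
  refine ⟨main, ?_⟩
  intro bh h1' h2' hmax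
  by_contra hcon
  have := main bh h1' h2' (not_le.mp hcon)
  have h5 := hmax r hsr hre
  have h6 : 0 ≤ contrastC T s r e X := abs_nonneg _
  have := pow_le_pow_left₀ h6 h5 2
  linarith
end

section
/- Let Z be a real random variable distributed as the Gaussian with mean 0 and variance 2, and let a ∈ ℝ. Then E[ erf(|a + Z|/2) ] = (1/2)·(1 + erf(a/(2√2))²), where E denotes expectation. -/
open Real MeasureTheory ProbabilityTheory intervalIntegral

/-- The Gauss error function `erf(x) = (2/√π) ∫₀ˣ e^{−t²} dt`. -/
noncomputable def erf (x : ℝ) : ℝ :=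
  (2 / Real.sqrt Real.pi) * ∫ t in (0 : ℝ)..x, Real.exp (-t ^ 2)

lemma g_symm {s : Set ℝ} (hs : MeasurableSet s) :
    (gaussianReal 0 2).real ((fun x => -x) ⁻¹' s) = (gaussianReal 0 2).real s := by
  have h := gaussianReal_map_neg (μ := 0) (v := 2)
  rw [neg_zero] at h
  conv_rhs => rw [← h]
  rw [map_measureReal_apply (by fun_prop) hs]

lemma g_Iio (x : ℝ) :
    (gaussianReal 0 2).real (Set.Iio (-x)) = 1 - (gaussianReal 0 2).real (Set.Iic x) := by
  have h := g_symm (measurableSet_Ioi (a := x))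
  have e : (fun x : ℝ => -x) ⁻¹' Set.Ioi x = Set.Iio (-x) := by
    ext y; simp [lt_neg]
  rw [e] at h
  rw [h, ← Set.compl_Iic, probReal_compl_eq_one_sub measurableSet_Iic]

lemma g_Iio_Iic (x : ℝ) :
    (gaussianReal 0 2).real (Set.Iio x) = (gaussianReal 0 2).real (Set.Iic x) := by
  haveI := nullSingletonClass_gaussianReal (μ := 0) (v := 2) (by norm_num)
  exact measureReal_congr Iio_ae_eq_Iic

lemma g_int (s : Set ℝ) :
    (gaussianReal 0 2).real s = ∫ x in s, gaussianPDFReal 0 2 x := by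
  rw [measureReal_def, gaussianReal_apply_eq_integral _ (by norm_num), ENNReal.toReal_ofReal]
  exact integral_nonneg fun x => gaussianPDFReal_nonneg _ _ _

lemma g_Iic (x : ℝ) :
    (gaussianReal 0 2).real (Set.Iic x) = (1 + erf (x / 2)) / 2 := by
  have h0 := g_Iio 0
  rw [neg_zero, g_Iio_Iic] at h0
  have h1 := integral_Iic_sub_Iic (μ := volume) (f := gaussianPDFReal 0 2) (a := 0) (b := x)
    (integrable_gaussianPDFReal _ _).integrableOn (integrable_gaussianPDFReal _ _).integrableOn
  rw [← g_int, ← g_int] at h1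
  have h2 : ∫ t in (0:ℝ)..x, gaussianPDFReal 0 2 t = erf (x / 2) / 2 := by
    have h3 := integral_comp_div (a := 0) (b := x) (fun t => rexp (-t ^ 2)) (two_ne_zero (α := ℝ))
    have e : ∀ t, gaussianPDFReal 0 2 t = (2 * √π)⁻¹ * rexp (-(t / 2) ^ 2) := by
      intro t
      have : √(2 * π * (2 : NNReal)) = 2 * √π := by
        rw [show 2 * π * ((2 : NNReal) : ℝ) = 2 ^ 2 * π by push_cast; ring,
          Real.sqrt_mul (by norm_num), Real.sqrt_sq (by norm_num)]
      rw [gaussianPDFReal, this]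
      congr 2
      push_cast; ring
    simp_rw [e]
    rw [intervalIntegral.integral_const_mul, h3, erf, zero_div, smul_eq_mul]
    have : √π ≠ 0 := by positivity
    field_simp
  linarith

lemma g_abs (x : ℝ) :
    (gaussianReal 0 2).real {w | |w| ≤ |x|} = erf (|x| / 2) := by
  have e : {w : ℝ | |w| ≤ |x|} = Set.Iic |x| \ Set.Iio (-|x|) := by
    ext w; simp [abs_le, and_comm]
  have hsub : Set.Iio (-|x|) ⊆ Set.Iic |x| := by
    intro w hw
    have := abs_nonneg x
    simp only [Set.mem_Iio, Set.mem_Iic] at *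
    linarith
  rw [e, measureReal_sdiff hsub measurableSet_Iio, g_Iio, g_Iic]
  ring

lemma g_main (a : ℝ) :
    ((gaussianReal 0 2).prod (gaussianReal 0 2)).real {p | |p.2| ≤ |a + p.1|} =
      (1 / 2) * (1 + erf (a / (2 * Real.sqrt 2)) ^ 2) := by
  set c := a / √2 with hc
  have hs : √2 * √2 = 2 := Real.mul_self_sqrt (by norm_num)
  have hs0 : 0 < √2 := by positivity
  have hac : a = √2 * c := by rw [hc]; field_simp
  have hrot := IsGaussian.map_rotation_eq_self (μ := gaussianReal 0 2) (by simp) (π / 4)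
  have hA : {p : ℝ × ℝ | |p.2| ≤ |a + p.1|} =
      (ContinuousLinearMap.rotation (π / 4)) ⁻¹'
        (Set.Iio (-c) ×ˢ Set.Iio c ∪ Set.Ioi (-c) ×ˢ Set.Ioi c)ᶜ := by
    ext ⟨z, w⟩
    rw [Set.mem_preimage, Set.mem_compl_iff, Set.mem_ofPred_eq, ← not_lt, not_iff_not,
      ContinuousLinearMap.rotation_apply, ← sq_lt_sq]
    simp only [Real.cos_pi_div_four, Real.sin_pi_div_four, smul_eq_mul, Set.mem_union,
      Set.mem_prod, Set.mem_Iio, Set.mem_Ioi]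
    have key : w ^ 2 - (a + z) ^ 2 =
        2 * ((√2 / 2 * z + √2 / 2 * w + c) * (-(√2 / 2) * z + √2 / 2 * w - c)) := by
      rw [hac]
      linear_combination (z ^ 2 / 2 - w ^ 2 / 2 - c ^ 2) * hs
    rw [← sub_pos, key, mul_pos_iff_of_pos_left two_pos, mul_pos_iff, or_comm]
    refine or_congr (and_congr ?_ ?_) (and_congr ?_ ?_) <;> constructor <;> intro h <;> linarith
  have hm : MeasurableSet (Set.Iio (-c) ×ˢ Set.Iio c ∪ Set.Ioi (-c) ×ˢ Set.Ioi c) := by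
    exact (measurableSet_Iio.prod measurableSet_Iio).union
      (measurableSet_Ioi.prod measurableSet_Ioi)
  rw [hA, ← map_measureReal_apply (by fun_prop) hm.compl, hrot, probReal_compl_eq_one_sub hm,
    measureReal_union, measureReal_prod_prod, measureReal_prod_prod, g_Iio, g_Iio_Iic,
    ← Set.compl_Iic, ← Set.compl_Iic, probReal_compl_eq_one_sub measurableSet_Iic,
    probReal_compl_eq_one_sub measurableSet_Iic, ← g_Iio_Iic (-c), g_Iio, g_Iic]
  · have : a / (2 * √2) = c / 2 := by rw [hc]; field_simp
    rw [this]; ring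
  · rw [Set.disjoint_left]
    rintro ⟨u, v⟩ h1 h2
    simp only [Set.mem_prod, Set.mem_Iio, Set.mem_Ioi] at h1 h2
    exact lt_asymm h1.1 h2.1
  · exact measurableSet_Ioi.prod measurableSet_Ioi

/-- for `Z` a centered Gaussian with variance `2` and `a ∈ ℝ`,
`E[erf(|a + Z|/2)] = (1/2)(1 + erf(a/(2√2))²)`. -/
theorem statement19 {Ω : Type*} [MeasurableSpace Ω] (P : Measure Ω) [IsProbabilityMeasure P]
    (Z : Ω → ℝ) (hZ : Measurable Z)
    (hZdist : Measure.map Z P = gaussianReal 0 2) (a : ℝ) :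
    ∫ ω, erf (|a + Z ω| / 2) ∂P =
      (1 / 2) * (1 + erf (a / (2 * Real.sqrt 2)) ^ 2) := by
  have hm : MeasurableSet {p : ℝ × ℝ | |p.2| ≤ |a + p.1|} :=
    measurableSet_le (by fun_prop) (by fun_prop)
  have hmeas : Measurable fun z : ℝ => erf (|a + z| / 2) := by
    simp_rw [← g_abs]
    exact (measurable_measure_prodMk_left (ν := gaussianReal 0 2) hm).ennreal_toReal
  rw [← g_main, ← integral_map (f := fun z => erf (|a + z| / 2)) hZ.aemeasurable
    hmeas.aestronglyMeasurable, hZdist, ← integral_indicator_one hm, integral_prod]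
  · congr 1
    ext z
    rw [← g_abs, ← integral_indicator_one (measurableSet_le (by fun_prop) (by fun_prop))]
    rfl
  · exact (integrable_const (1 : ℝ)).indicator hm
end
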